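/- Let α ∈ (1/2,1), σ > 0 and φ(t) = ασ(1+σt)^{-(α+1)}. There exists a constant C > 0 such that for every ζ ∈ (0,1), the resolvent R_ζ(t) = ∑_{k=1}^∞ ζ^k φ^{*k}(t) is differentiable on (0,∞) and its derivative satisfies |R_ζ'(t)| ≤ C (1+t)^{α−2} for all t > 0. -/

import Mathlib

open MeasureTheory Real Filter Set

/-- Convolution of two functions on `[0,∞)`: `(f * g)(t) = ∫_0^t f(t-s) g(s) ds`. -/
noncomputable def conv (f g : ℝ → ℝ) : ℝ → ℝ := fun t => ∫ s in (0:ℝ)..t, f (t - s) * g s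

/-- Convolution powers: `convPow f k = f^{*(k+1)}`, i.e. `convPow f 0 = f`. -/
noncomputable def convPow (f : ℝ → ℝ) : ℕ → ℝ → ℝ
  | 0 => f
  | (k + 1) => conv f (convPow f k)

lemma conv_cont {f g : ℝ → ℝ} (hf : Continuous f) (hg : Continuous g) :
    Continuous (conv f g) := by
  unfold conv
  apply intervalIntegral.continuous_parametric_intervalIntegral_of_continuous
  · simp only [Function.uncurry_def]; fun_prop
  · exact continuous_id

lemma conv_congr {f f' g g' : ℝ → ℝ} {t : ℝ} (ht : 0 ≤ t) (hf : ∀ s, 0 ≤ s → f s = f' s)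
    (hg : ∀ s, 0 ≤ s → g s = g' s) : conv f g t = conv f' g' t := by
  unfold conv
  apply intervalIntegral.integral_congr
  intro s hs
  rw [uIcc_of_le ht] at hs
  simp only
  rw [hf _ (by linarith [hs.2]), hg _ hs.1]

lemma conv_comm' (f g : ℝ → ℝ) (t : ℝ) : conv f g t = conv g f t := by
  unfold conv
  have := intervalIntegral.integral_comp_sub_left (a := 0) (b := t) (fun s => f s * g (t - s)) t
  simp only [sub_self, sub_zero, sub_sub_cancel] at this
  rw [this]
  congr 1; ext s; ring

lemma conv_one (f : ℝ → ℝ) (t : ℝ) : conv (fun _ => 1) f t = ∫ s in (0:ℝ)..t, f s := by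
  simp [conv]

lemma triangle_swap {F : ℝ → ℝ → ℝ} (hF : Continuous F.uncurry) {t : ℝ} (ht : 0 ≤ t) :
    ∫ s in (0:ℝ)..t, ∫ u in (0:ℝ)..s, F s u = ∫ u in (0:ℝ)..t, ∫ s in u..t, F s u := by
  have h1 : ∀ s ∈ Ioc (0:ℝ) t, ∫ u in (0:ℝ)..s, F s u
      = ∫ u in Ioc 0 t, {q : ℝ × ℝ | q.2 ≤ q.1}.indicator F.uncurry (s, u) := by
    intro s hs
    rw [intervalIntegral.integral_of_le hs.1.le]
    have : (fun u => {q : ℝ × ℝ | q.2 ≤ q.1}.indicator F.uncurry (s, u))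
      = (Iic s).indicator (fun u => F s u) := by
      ext u; simp [indicator]
    rw [this, setIntegral_indicator measurableSet_Iic]
    congr 2
    ext u; simp only [mem_Ioc, mem_inter_iff, mem_Iic]
    constructor
    · rintro ⟨a, b⟩; exact ⟨⟨a, b.trans hs.2⟩, b⟩
    · rintro ⟨⟨a, b⟩, c⟩; exact ⟨a, c⟩
  have h2 : ∀ u ∈ Ioc (0:ℝ) t, ∫ s in u..t, F s u
      = ∫ s in Ioc 0 t, {q : ℝ × ℝ | q.2 ≤ q.1}.indicator F.uncurry (s, u) := by
    intro u hu
    rw [intervalIntegral.integral_of_le hu.2, ← integral_Icc_eq_integral_Ioc]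
    have : (fun s => {q : ℝ × ℝ | q.2 ≤ q.1}.indicator F.uncurry (s, u))
      = (Ici u).indicator (fun s => F s u) := by
      ext s; simp [indicator]
    rw [this, setIntegral_indicator measurableSet_Ici]
    congr 2
    ext s; simp only [mem_Ioc, mem_inter_iff, mem_Ici, mem_Icc]
    constructor
    · rintro ⟨a, b⟩; exact ⟨⟨hu.1.trans_le a, b⟩, a⟩
    · rintro ⟨⟨a, b⟩, c⟩; exact ⟨c, b⟩
  rw [intervalIntegral.integral_of_le ht, intervalIntegral.integral_of_le ht,
    setIntegral_congr_fun measurableSet_Ioc h1, setIntegral_congr_fun measurableSet_Ioc h2]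
  apply integral_integral_swap
  rw [Measure.prod_restrict]
  have hI : IntegrableOn F.uncurry (Ioc 0 t ×ˢ Ioc 0 t) (volume.prod volume) := by
    have : IntegrableOn F.uncurry (Icc 0 t ×ˢ Icc 0 t) (volume.prod volume) := by
      apply hF.continuousOn.integrableOn_compact
      exact isCompact_Icc.prod isCompact_Icc
    exact this.mono_set (prod_mono Ioc_subset_Icc_self Ioc_subset_Icc_self)
  exact Integrable.indicator hI (measurableSet_le measurable_snd measurable_fst)

lemma conv_assoc' {f g h : ℝ → ℝ} (hf : Continuous f) (hg : Continuous g) (hh : Continuous h)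
    {t : ℝ} (ht : 0 ≤ t) : conv f (conv g h) t = conv (conv f g) h t := by
  have h1 : conv f (conv g h) t
      = ∫ s in (0:ℝ)..t, ∫ u in (0:ℝ)..s, f (t - s) * (g (s - u) * h u) := by
    simp only [conv, intervalIntegral.integral_const_mul]
  rw [h1, triangle_swap (F := fun s u => f (t - s) * (g (s - u) * h u)) _ ht]
  · show _ = ∫ u in (0:ℝ)..t, conv f g (t - u) * h u
    congr 1; ext u
    have := intervalIntegral.integral_comp_add_right (a := 0) (b := t - u)
      (fun s => f (t - s) * (g (s - u) * h u)) u
    simp only [zero_add, sub_add_cancel, add_sub_cancel_right] at this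
    rw [← this, conv, ← intervalIntegral.integral_mul_const]
    congr 1; ext s
    rw [show t - (s + u) = t - u - s by ring]; ring
  · simp only [Function.uncurry_def]; fun_prop

lemma conv_add_left {f g h : ℝ → ℝ} (hf : Continuous f) (hg : Continuous g) (hh : Continuous h)
    (t : ℝ) : conv (fun s => f s + g s) h t = conv f h t + conv g h t := by
  unfold conv
  rw [← intervalIntegral.integral_add]
  · congr 1; ext s; ring
  all_goals exact Continuous.intervalIntegrable (by fun_prop) _ _

lemma conv_smul_left (c : ℝ) (f h : ℝ → ℝ)
    (t : ℝ) : conv (fun s => c * f s) h t = c * conv f h t := by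
  unfold conv
  rw [← intervalIntegral.integral_const_mul]
  congr 1; ext s; ring

lemma conv_add_right {f g h : ℝ → ℝ} (hf : Continuous f) (hg : Continuous g) (hh : Continuous h)
    (t : ℝ) : conv h (fun s => f s + g s) t = conv h f t + conv h g t := by
  rw [conv_comm', conv_add_left hf hg hh, conv_comm' f, conv_comm' g]

lemma conv_smul_right (c : ℝ) (f h : ℝ → ℝ)
    (t : ℝ) : conv h (fun s => c * f s) t = c * conv h f t := by
  rw [conv_comm', conv_smul_left, conv_comm']

lemma conv_const (c : ℝ) (f : ℝ → ℝ) (t : ℝ) :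
    conv (fun _ => c) f t = c * ∫ s in (0:ℝ)..t, f s := by
  simp [conv]

lemma conv_nonneg {f g : ℝ → ℝ} {t : ℝ} (ht : 0 ≤ t) (hf : ∀ s, 0 ≤ s → 0 ≤ f s)
    (hg : ∀ s, 0 ≤ s → 0 ≤ g s) : 0 ≤ conv f g t := by
  apply intervalIntegral.integral_nonneg ht
  intro s hs
  exact mul_nonneg (hf _ (by linarith [hs.2])) (hg _ hs.1)

lemma conv_le_left {f f' g : ℝ → ℝ} (hf : Continuous f) (hf' : Continuous f') (hg : Continuous g)
    {t : ℝ} (ht : 0 ≤ t) (hff : ∀ s, 0 ≤ s → s ≤ t → f s ≤ f' s)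
    (hg0 : ∀ s, 0 ≤ s → 0 ≤ g s) : conv f g t ≤ conv f' g t := by
  unfold conv
  apply intervalIntegral.integral_mono_on ht
  · exact Continuous.intervalIntegrable (by fun_prop) _ _
  · exact Continuous.intervalIntegrable (by fun_prop) _ _
  · intro s hs
    exact mul_le_mul_of_nonneg_right (hff _ (by linarith [hs.2]) (by linarith [hs.1])) (hg0 _ hs.1)

/-- Leibniz rule in integrated form. -/
lemma conv_leibniz {f fd h : ℝ → ℝ} (hfd : Continuous fd)
    (hh : Continuous h) (hF : ∀ t, 0 ≤ t → f t = f 0 + ∫ s in (0:ℝ)..t, fd s) {t : ℝ}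
    (ht : 0 ≤ t) : conv f h t = ∫ u in (0:ℝ)..t, (f 0 * h u + conv fd h u) := by
  have c1 : Continuous (conv (fun _ => (1:ℝ)) fd) := conv_cont continuous_const hfd
  have c2 : Continuous (conv fd h) := conv_cont hfd hh
  have h1 : conv f h t = conv (fun s => f 0 + conv (fun _ => 1) fd s) h t := by
    apply conv_congr ht
    · intro s hs; rw [conv_one]; exact hF s hs
    · intros; rfl
  rw [h1, conv_add_left continuous_const c1 hh, conv_const,
    ← conv_assoc' continuous_const hfd hh ht, conv_one, intervalIntegral.integral_add,
    intervalIntegral.integral_const_mul]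
  all_goals exact Continuous.intervalIntegrable (by fun_prop) _ _

lemma eq_of_integral_eq {f h : ℝ → ℝ} (hf : Continuous f) (hh : Continuous h)
    (H : ∀ t, 0 ≤ t → ∫ s in (0:ℝ)..t, f s = ∫ s in (0:ℝ)..t, h s) {t : ℝ} (ht : 0 ≤ t) :
    f t = h t := by
  have d1 : HasDerivWithinAt (fun t => ∫ s in (0:ℝ)..t, f s) (f t) (Ici t) t :=
    (hf.integral_hasStrictDerivAt 0 t).hasDerivAt.hasDerivWithinAt
  have d2 : HasDerivWithinAt (fun t => ∫ s in (0:ℝ)..t, h s) (h t) (Ici t) t :=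
    (hh.integral_hasStrictDerivAt 0 t).hasDerivAt.hasDerivWithinAt
  have d3 : HasDerivWithinAt (fun t => ∫ s in (0:ℝ)..t, f s) (h t) (Ici t) t := by
    apply d2.congr
    · intro x hx; exact H x (ht.trans hx)
    · exact H t ht
  exact (uniqueDiffWithinAt_Ici t).eq_deriv _ d1 d3

lemma conv_mul_id {f h : ℝ → ℝ} (hf : Continuous f) (hh : Continuous h) (t : ℝ) :
    t * conv f h t = conv (fun s => s * f s) h t + conv f (fun s => s * h s) t := by
  unfold conv
  rw [← intervalIntegral.integral_const_mul, ← intervalIntegral.integral_add]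
  · congr 1; ext s; ring
  all_goals exact Continuous.intervalIntegrable (by fun_prop) _ _

/-- Properties of the kernel `p` (with derivative `pd` and tail `Q`). -/
structure Ker (α σ : ℝ) (p pd Q : ℝ → ℝ) : Prop where
  hα0 : 0 < α
  hα1 : α < 1
  hσ : 0 < σ
  cp : Continuous p
  cpd : Continuous pd
  cQ : Continuous Q
  p0 : p 0 = α * σ
  Q0 : Q 0 = 1
  ip : ∀ t, 0 ≤ t → p t = p 0 + ∫ s in (0:ℝ)..t, pd s
  iQ : ∀ t, 0 ≤ t → Q t = 1 - ∫ s in (0:ℝ)..t, p s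
  pB : ∀ t, 0 ≤ t → (1 + σ * t) * p t = α * σ * Q t
  pdB : ∀ t, 0 ≤ t → (1 + σ * t) * pd t = -((α + 1) * σ * p t)
  ppos : ∀ t, 0 ≤ t → 0 < p t
  Qpos : ∀ t, 0 ≤ t → 0 < Q t
  panti : ∀ s t, 0 ≤ s → s ≤ t → p t ≤ p s
  Qanti : ∀ s t, 0 ≤ s → s ≤ t → Q t ≤ Q s

/-- `r` is the resolvent of `ζ p`. -/
structure Res (ζ : ℝ) (p r : ℝ → ℝ) : Prop where
  ζ0 : 0 < ζ
  ζ1 : ζ < 1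
  cr : Continuous r
  r0 : ∀ t, 0 ≤ t → 0 ≤ r t
  hr : ∀ t, 0 ≤ t → r t = ζ * p t + ζ * conv p r t

noncomputable def rdf (ζ : ℝ) (p pd r : ℝ → ℝ) : ℝ → ℝ :=
  fun t => ζ * pd t + ζ * (p 0 * r t + conv pd r t)

section
variable {α σ ζ : ℝ} {p pd Q r : ℝ → ℝ}

lemma Res.zero (H : Res ζ p r) : r 0 = ζ * p 0 := by
  have := H.hr 0 le_rfl
  simpa [conv] using this

lemma rd_cont (h : Ker α σ p pd Q) (H : Res ζ p r) : Continuous (rdf ζ p pd r) := by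
  have := conv_cont h.cpd H.cr
  have := h.cpd
  have := H.cr
  unfold rdf; fun_prop

lemma rd_int (h : Ker α σ p pd Q) (H : Res ζ p r) {t : ℝ} (ht : 0 ≤ t) :
    r t = r 0 + ∫ s in (0:ℝ)..t, rdf ζ p pd r s := by
  have c1 := conv_cont h.cpd H.cr
  have c2 := h.cpd
  have c3 := H.cr
  have e : ∫ s in (0:ℝ)..t, rdf ζ p pd r s = ζ * (∫ s in (0:ℝ)..t, pd s) +
      ζ * ∫ s in (0:ℝ)..t, (p 0 * r s + conv pd r s) := by
    unfold rdf
    rw [intervalIntegral.integral_add, intervalIntegral.integral_const_mul,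
      intervalIntegral.integral_const_mul]
    all_goals exact Continuous.intervalIntegrable (by fun_prop) _ _
  rw [e, H.hr t ht, H.zero, conv_leibniz h.cpd H.cr h.ip ht, h.ip t ht]
  ring

lemma rd_eq1 (h : Ker α σ p pd Q) (H : Res ζ p r) {t : ℝ} (ht : 0 ≤ t) :
    rdf ζ p pd r t = ζ * pd t + ζ * (r 0 * p t + conv (rdf ζ p pd r) p t) := by
  have c0 := rd_cont h H
  have c1 := conv_cont c0 h.cp
  have c2 := h.cpd
  have c3 := h.cp
  apply eq_of_integral_eq (h := fun t => ζ * pd t + ζ * (r 0 * p t + conv (rdf ζ p pd r) p t))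
    c0 (by fun_prop) _ ht
  intro t ht
  have e1 := rd_int h H ht
  have e2 := H.hr t ht
  rw [conv_comm', conv_leibniz c0 h.cp (fun t ht => rd_int h H ht) ht] at e2
  rw [intervalIntegral.integral_add, intervalIntegral.integral_const_mul,
    intervalIntegral.integral_const_mul]
  · have e3 := h.ip t ht
    have e4 := H.zero
    linear_combination e2 - e1 + ζ * e3 - e4
  all_goals exact Continuous.intervalIntegrable (by fun_prop) _ _

lemma eqK (h : Ker α σ p pd Q) (H : Res ζ p r) {t : ℝ} (ht : 0 ≤ t) :
    conv (fun s => (1 - ζ) + ζ * Q s) r t = ζ * ∫ s in (0:ℝ)..t, p s := by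
  have c2 := h.cp
  have c3 := H.cr
  have e := conv_leibniz (f := fun s => (1 - ζ) + ζ * Q s) (fd := fun s => -ζ * p s)
    (by fun_prop) H.cr (by
      intro t ht
      rw [intervalIntegral.integral_const_mul, h.iQ t ht, h.Q0]; ring) ht
  rw [e, ← intervalIntegral.integral_const_mul]
  apply intervalIntegral.integral_congr
  intro s hs
  rw [uIcc_of_le ht] at hs
  simp only
  rw [conv_smul_left, h.Q0]
  linear_combination H.hr s hs.1

lemma rd_eq2 (h : Ker α σ p pd Q) (H : Res ζ p r) {t : ℝ} (ht : 0 ≤ t) :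
    r 0 * ((1 - ζ) + ζ * Q t) + conv (rdf ζ p pd r) (fun s => (1 - ζ) + ζ * Q s) t
      = ζ * p t := by
  have c0 := rd_cont h H
  have c2 := h.cp
  have c3 := h.cQ
  have c4 : Continuous (fun s => (1 - ζ) + ζ * Q s) := by fun_prop
  have c1 := conv_cont c0 c4
  apply eq_of_integral_eq (f := fun t => r 0 * ((1 - ζ) + ζ * Q t) +
    conv (rdf ζ p pd r) (fun s => (1 - ζ) + ζ * Q s) t) (h := fun t => ζ * p t)
    (by fun_prop) (by fun_prop) _ ht
  intro t ht
  have e := eqK h H ht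
  rw [conv_comm', conv_leibniz c0 c4 (fun t ht => rd_int h H ht) ht] at e
  rw [e, intervalIntegral.integral_const_mul]

lemma rd_neg (h : Ker α σ p pd Q) (H : Res ζ p r) {t : ℝ} (ht : 0 ≤ t) :
    rdf ζ p pd r t < 0 := by
  by_contra hcon
  push Not at hcon
  have c0 := rd_cont h H
  set rd := rdf ζ p pd r with hrd
  let S : Set ℝ := Ici 0 ∩ {t | 0 ≤ rd t}
  have hS : IsClosed S := isClosed_Ici.inter (isClosed_le continuous_const c0)
  have hne : S.Nonempty := ⟨t, ht, hcon⟩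
  have hbd : BddBelow S := ⟨0, fun x hx => hx.1⟩
  obtain ⟨hT0, hT1⟩ := hS.csInf_mem hne hbd
  set T := sInf S with hT
  have hT0 : 0 ≤ T := hT0
  have hT1 : 0 ≤ rd T := hT1
  have hlt : ∀ s, 0 ≤ s → s < T → rd s < 0 := by
    intro s hs hsT
    by_contra hc
    push Not at hc
    exact absurd (csInf_le hbd (show s ∈ S from ⟨hs, hc⟩)) (not_le.mpr hsT)
  have e1 := rd_eq1 h H hT0
  have e2 := rd_eq2 h H hT0
  rw [← hrd] at e1 e2
  set KT := (1 - ζ) + ζ * Q T with hKT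
  have c2 := h.cp
  have c3 := h.cQ
  have hζ0 := H.ζ0
  have hζ1 := H.ζ1
  have hα := h.hα0
  have hσ := h.hσ
  have hpT := h.ppos T hT0
  have hQT := h.Qpos T hT0
  have e3 : KT * conv rd p T - p T * conv rd (fun s => (1 - ζ) + ζ * Q s) T
      = ∫ s in (0:ℝ)..T, rd (T - s) * (KT * p s - p T * ((1 - ζ) + ζ * Q s)) := by
    unfold conv
    rw [← intervalIntegral.integral_const_mul, ← intervalIntegral.integral_const_mul,
      ← intervalIntegral.integral_sub]
    · congr 1; ext s; ring
    all_goals exact Continuous.intervalIntegrable (by fun_prop) _ _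
  have e4 : ∫ s in (0:ℝ)..T, rd (T - s) * (KT * p s - p T * ((1 - ζ) + ζ * Q s)) ≤ 0 := by
    have : ∫ s in (0:ℝ)..T, rd (T - s) * (KT * p s - p T * ((1 - ζ) + ζ * Q s)) ≤
        ∫ s in (0:ℝ)..T, (0:ℝ) := by
      apply intervalIntegral.integral_mono_on_of_le_Ioo hT0
      · exact Continuous.intervalIntegrable (by fun_prop) _ _
      · exact Continuous.intervalIntegrable (by fun_prop) _ _
      · intro s hs
        apply mul_nonpos_of_nonpos_of_nonneg
        · exact (hlt _ (by linarith [hs.2]) (by linarith [hs.1])).le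
        · have b1 := h.pB T hT0
          have b2 := h.pB s hs.1.le
          have b3 := h.panti s T hs.1.le hs.2.le
          have b4 : α * σ * (Q T * p s - p T * Q s) = σ * (T - s) * (p T * p s) := by
            linear_combination (-p s) * b1 + p T * b2
          have b5 : 0 ≤ Q T * p s - p T * Q s := by
            have : 0 ≤ α * σ * (Q T * p s - p T * Q s) := by
              rw [b4]
              have := h.ppos s hs.1.le
              have : 0 < T - s := by linarith [hs.2]
              positivity
            exact nonneg_of_mul_nonneg_right this (by positivity)
          have b6 : KT * p s - p T * ((1 - ζ) + ζ * Q s) =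
            (1 - ζ) * (p s - p T) + ζ * (Q T * p s - p T * Q s) := by rw [hKT]; ring
          rw [b6]
          have := mul_nonneg (by linarith : 0 ≤ 1 - ζ) (by linarith : 0 ≤ p s - p T)
          have := mul_nonneg hζ0.le b5
          linarith
    simpa using this
  have e5 : KT * rd T = ζ * (KT * pd T + ζ * p T ^ 2) +
      ζ * (KT * conv rd p T - p T * conv rd (fun s => (1 - ζ) + ζ * Q s) T) := by
    linear_combination KT * e1 + ζ * p T * e2
  have hB : 0 < 1 + σ * T := by positivity
  have e6 : (1 + σ * T) * (KT * pd T + ζ * p T ^ 2) = -(p T * σ *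
      ((α + 1) * (1 - ζ) + ζ * Q T)) := by
    linear_combination KT * h.pdB T hT0 + ζ * p T * h.pB T hT0 + (-(α + 1) * σ * p T) * hKT
  have e7 : KT * pd T + ζ * p T ^ 2 < 0 := by
    have : (1 + σ * T) * (KT * pd T + ζ * p T ^ 2) < 0 := by
      rw [e6]
      have : 0 < 1 - ζ := by linarith
      have : 0 < p T * σ * ((α + 1) * (1 - ζ) + ζ * Q T) := by positivity
      linarith
    exact neg_of_mul_neg_right this hB.le
  have hK0 : 0 ≤ KT := by
    have : 0 < 1 - ζ := by linarith
    positivity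
  have e8 : 0 ≤ KT * rd T := mul_nonneg hK0 hT1
  rw [e5, e3] at e8
  nlinarith

lemma r_anti (h : Ker α σ p pd Q) (H : Res ζ p r) {s t : ℝ} (hs : 0 ≤ s) (hst : s ≤ t) :
    r t ≤ r s := by
  have c0 := rd_cont h H
  rw [rd_int h H hs, rd_int h H (hs.trans hst),
    ← intervalIntegral.integral_add_adjacent_intervals (b := s)
      (c0.intervalIntegrable _ _) (c0.intervalIntegrable _ _)]
  have : ∫ x in s..t, rdf ζ p pd r x ≤ ∫ x in s..t, (0:ℝ) := by
    apply intervalIntegral.integral_mono_on hst (c0.intervalIntegrable _ _) (by simp)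
    intro x hx
    exact (rd_neg h H (hs.trans hx.1)).le
  simp only [intervalIntegral.integral_zero] at this
  linarith

lemma eqK_le (h : Ker α σ p pd Q) (H : Res ζ p r) {t : ℝ} (ht : 0 ≤ t) :
    conv (fun s => (1 - ζ) + ζ * Q s) r t ≤ 1 := by
  rw [eqK h H ht]
  have := h.iQ t ht
  have := h.Qpos t ht
  nlinarith [H.ζ0, H.ζ1]

lemma U_le1 (h : Ker α σ p pd Q) (H : Res ζ p r) {t : ℝ} (ht : 0 ≤ t) :
    (1 - ζ) * (∫ s in (0:ℝ)..t, r s) ≤ 1 := by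
  have c3 := h.cQ
  rw [← conv_const]
  refine le_trans ?_ (eqK_le h H ht)
  apply conv_le_left continuous_const (by fun_prop) H.cr ht _ H.r0
  intro s hs _
  have := mul_pos H.ζ0 (h.Qpos s hs)
  linarith

lemma U_le2 (h : Ker α σ p pd Q) (H : Res ζ p r) {t : ℝ} (ht : 0 ≤ t) :
    Q t * (∫ s in (0:ℝ)..t, r s) ≤ 1 := by
  have c3 := h.cQ
  rw [← conv_const]
  refine le_trans ?_ (eqK_le h H ht)
  apply conv_le_left continuous_const (by fun_prop) H.cr ht _ H.r0
  intro s hs hst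
  have b1 := h.Qanti s t hs hst
  have b2 := h.Qanti 0 t le_rfl ht
  rw [h.Q0] at b2
  nlinarith [H.ζ0, H.ζ1]

lemma r_bound (h : Ker α σ p pd Q) (H : Res ζ p r) {t : ℝ} (ht : 0 ≤ t) :
    (1 + σ * t) * r t * Q t ≤ 2 * σ := by
  have hσ := h.hσ
  have hα := h.hα0
  have hα1 := h.hα1
  have b1 : t * r t ≤ ∫ s in (0:ℝ)..t, r s := by
    have : ∫ s in (0:ℝ)..t, r t ≤ ∫ s in (0:ℝ)..t, r s := by
      apply intervalIntegral.integral_mono_on ht (by simp) (H.cr.intervalIntegrable _ _)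
      intro x hx
      exact r_anti h H hx.1 hx.2
    simpa using this
  have b2 := U_le2 h H ht
  have hQ := h.Qpos t ht
  have b3 : Q t ≤ 1 := by rw [← h.Q0]; exact h.Qanti 0 t le_rfl ht
  have b4 : r t ≤ σ := by
    have := r_anti h H le_rfl ht
    rw [H.zero, h.p0] at this
    have : ζ * (α * σ) ≤ 1 * (1 * σ) := by
      have := H.ζ1
      have := H.ζ0
      gcongr
    linarith
  have b5 : t * r t * Q t ≤ 1 := by
    calc t * r t * Q t ≤ (∫ s in (0:ℝ)..t, r s) * Q t := by gcongr
      _ ≤ 1 := by linarith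
  have b6 : r t * Q t ≤ σ * 1 := by
    have := H.r0 t ht
    gcongr
  nlinarith

lemma rr_bound (h : Ker α σ p pd Q) (H : Res ζ p r) {t : ℝ} (ht : 0 ≤ t) :
    (1 - ζ) * conv r r t ≤ 2 * r (t / 2) := by
  have c := H.cr
  have hm := H.r0 (t / 2) (by positivity)
  have b1 : conv r r t ≤ ∫ s in (0:ℝ)..t, r (t / 2) * (r (t - s) + r s) := by
    unfold conv
    apply intervalIntegral.integral_mono_on ht
    · exact Continuous.intervalIntegrable (by fun_prop) _ _
    · exact Continuous.intervalIntegrable (by fun_prop) _ _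
    · intro s hs
      have a1 := H.r0 s hs.1
      have a2 := H.r0 (t - s) (by linarith [hs.2])
      rcases le_total s (t / 2) with hc | hc
      · have := r_anti h H (s := t / 2) (t := t - s) (by positivity) (by linarith)
        nlinarith
      · have := r_anti h H (s := t / 2) (t := s) (by positivity) (by linarith)
        nlinarith
  have b2 : ∫ s in (0:ℝ)..t, r (t / 2) * (r (t - s) + r s)
      = 2 * r (t / 2) * ∫ s in (0:ℝ)..t, r s := by
    rw [intervalIntegral.integral_const_mul, intervalIntegral.integral_add]
    · rw [intervalIntegral.integral_comp_sub_left (fun s => r s)]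
      simp only [sub_self, sub_zero]; ring
    all_goals exact Continuous.intervalIntegrable (by fun_prop) _ _
  have b3 := U_le1 h H ht
  rw [b2] at b1
  have := mul_le_mul_of_nonneg_left b1 (by linarith [H.ζ1] : 0 ≤ 1 - ζ)
  nlinarith

lemma rd_identity (h : Ker α σ p pd Q) (H : Res ζ p r) {t : ℝ} (ht : 0 ≤ t) :
    r t + t * rdf ζ p pd r t = -(α * (1 - ζ)) * r t - rdf ζ p pd r t / σ
      - α * (1 - ζ) * conv r r t - conv (rdf ζ p pd r) r t / σ := by
  have cr := H.cr
  have cp := h.cp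
  have cQ := h.cQ
  have c0 := rd_cont h H
  have hσ := h.hσ
  have hr0 : r 0 = ζ * (α * σ) := by rw [H.zero, h.p0]
  set rd := rdf ζ p pd r with hrd
  let X : ℝ → ℝ := fun t => t * r t
  have cX : Continuous X := by fun_prop
  let Fd : ℝ → ℝ := fun t => -(α * (1 - ζ)) * r t + (-(1 / σ)) * rd t
  have cFd : Continuous Fd := by fun_prop
  let F : ℝ → ℝ := fun t => ∫ s in (0:ℝ)..t, Fd s
  have cF : Continuous F := by
    have := conv_cont (f := fun _ => (1:ℝ)) continuous_const cFd
    have e : conv (fun _ => (1:ℝ)) Fd = F := by ext t; rw [conv_one]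
    rwa [e] at this
  have hF : ∀ t, 0 ≤ t → F t = α * (1 - (1 - ζ) * (1 + ∫ s in (0:ℝ)..t, r s)) - r t / σ := by
    intro t ht
    have e := rd_int h H ht
    simp only [F, Fd]
    rw [intervalIntegral.integral_add, intervalIntegral.integral_const_mul,
      intervalIntegral.integral_const_mul]
    · rw [e, hr0]; field_simp; ring
    all_goals exact Continuous.intervalIntegrable (by fun_prop) _ _
  -- the equation for `X`
  have hX : ∀ t, 0 ≤ t → X t = F t + ζ * conv p X t := by
    intro t ht
    have e1 := conv_mul_id cp cr t
    have tp : ∀ t, 0 ≤ t → t * p t = α * Q t + (-(1 / σ)) * p t := by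
      intro t ht
      have := h.pB t ht
      field_simp
      linear_combination this
    have e2 : conv (fun s => s * p s) r t = α * conv Q r t + (-(1 / σ)) * conv p r t := by
      rw [conv_congr ht tp (fun _ _ => rfl), conv_add_left (by fun_prop) (by fun_prop) cr,
        conv_smul_left, conv_smul_left]
    have e3 := eqK h H ht
    rw [conv_add_left continuous_const (by fun_prop) cr, conv_const, conv_smul_left] at e3
    have e4 := H.hr t ht
    have e5 := tp t ht
    have e6 := h.iQ t ht
    rw [hF t ht]
    simp only [X]
    linear_combination t * e4 + ζ * e1 + ζ * e2 + α * e3 + ζ * e5 + ζ * α * e6 + (1 / σ) * e4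
  have hX2 : ∀ t, 0 ≤ t → X t = F t + conv F r t := by
    intro t ht
    have cpX := conv_cont cp cX
    have cpr := conv_cont cp cr
    have e1 : conv r X t = conv r F t + ζ * conv r (conv p X) t := by
      rw [conv_congr (f' := r) ht (fun _ _ => rfl) hX,
        conv_add_right cF (by fun_prop) cr, conv_smul_right]
    have e2 : conv r X t = ζ * conv p X t + ζ * conv (conv p r) X t := by
      rw [conv_congr (g' := X) ht H.hr (fun _ _ => rfl),
        conv_add_left (by fun_prop) (by fun_prop) cX, conv_smul_left, conv_smul_left]
    have e3 : conv r (conv p X) t = conv (conv p r) X t := by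
      rw [conv_assoc' cr cp cX ht]
      exact conv_congr ht (fun _ _ => conv_comm' _ _ _) (fun _ _ => rfl)
    rw [hX t ht, conv_comm' F]
    linear_combination e1 - e2 + ζ * e3
  have hF0 : F 0 = 0 := by simp [F]
  have hX3 : ∀ t, 0 ≤ t → X t = ∫ s in (0:ℝ)..t, (Fd s + conv Fd r s) := by
    intro t ht
    have c := conv_cont cFd cr
    rw [hX2 t ht, conv_leibniz cFd cr (fun t _ => by rw [hF0, zero_add]) ht,
      ← intervalIntegral.integral_add]
    · congr 1; ext s; rw [hF0]; ring
    all_goals exact Continuous.intervalIntegrable (by fun_prop) _ _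
  have c := conv_cont cFd cr
  have d1 : HasDerivWithinAt X (Fd t + conv Fd r t) (Ici t) t := by
    have cc : Continuous (fun s => Fd s + conv Fd r s) := by fun_prop
    apply (cc.integral_hasStrictDerivAt 0 t).hasDerivAt.hasDerivWithinAt.congr
    · intro x hx; exact hX3 x (ht.trans hx)
    · exact hX3 t ht
  have d2 : HasDerivWithinAt r (rd t) (Ici t) t := by
    apply ((c0.integral_hasStrictDerivAt 0 t).hasDerivAt.const_add (r 0)).hasDerivWithinAt.congr
    · intro x hx; exact rd_int h H (ht.trans hx)
    · exact rd_int h H ht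
  have d3 : HasDerivWithinAt X (1 * r t + t * rd t) (Ici t) t :=
    (hasDerivWithinAt_id t _).mul d2
  have e := (uniqueDiffWithinAt_Ici t).eq_deriv _ d3 d1
  rw [conv_add_left (by fun_prop) (by fun_prop) cr, conv_smul_left, conv_smul_left] at e
  simp only [Fd] at e
  linear_combination e

lemma rd_bound (h : Ker α σ p pd Q) (H : Res ζ p r) {t : ℝ} (ht : 0 ≤ t) :
    -rdf ζ p pd r t * ((1 + σ * t) * (1 + σ * (t / 2)) * Q (t / 2)) ≤ 8 * σ ^ 2 := by
  have hσ := h.hσ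
  have hα := h.hα0
  have hα1 := h.hα1
  have hζ0 := H.ζ0
  have hζ1 := H.ζ1
  have ht2 : 0 ≤ t / 2 := by positivity
  have e := rd_identity h H ht
  have n1 : conv (rdf ζ p pd r) r t ≤ 0 := by
    have : 0 ≤ conv (fun s => (-1) * rdf ζ p pd r s) r t :=
      conv_nonneg ht (fun s hs => by linarith [rd_neg h H hs]) H.r0
    rw [conv_smul_left] at this
    linarith
  have n2 := rr_bound h H ht
  have n3 := r_bound h H ht2
  have n4 := r_anti h H ht2 (by linarith : t / 2 ≤ t)
  have n5 := H.r0 t ht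
  have n6 : 0 ≤ conv r r t := conv_nonneg ht H.r0 H.r0
  have e1 : -rdf ζ p pd r t * (1 + σ * t) = σ * ((1 + α * (1 - ζ)) * r t
      + α * ((1 - ζ) * conv r r t)) + conv (rdf ζ p pd r) r t := by
    field_simp at e
    linear_combination -e
  have n7 : (1 + α * (1 - ζ)) * r t ≤ 2 * r t := by
    apply mul_le_mul_of_nonneg_right _ n5
    nlinarith
  have n8 : α * ((1 - ζ) * conv r r t) ≤ 1 * ((1 - ζ) * conv r r t) := by
    apply mul_le_mul_of_nonneg_right hα1.le
    exact mul_nonneg (by linarith) n6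
  have n9 : -rdf ζ p pd r t * (1 + σ * t) ≤ σ * (4 * r (t / 2)) := by
    rw [e1]
    have : σ * ((1 + α * (1 - ζ)) * r t + α * ((1 - ζ) * conv r r t)) ≤ σ * (4 * r (t / 2)) := by
      apply mul_le_mul_of_nonneg_left _ hσ.le
      linarith
    linarith
  have hQ := h.Qpos _ ht2
  calc -rdf ζ p pd r t * ((1 + σ * t) * (1 + σ * (t / 2)) * Q (t / 2))
      = (-rdf ζ p pd r t * (1 + σ * t)) * ((1 + σ * (t / 2)) * Q (t / 2)) := by ring
    _ ≤ (σ * (4 * r (t / 2))) * ((1 + σ * (t / 2)) * Q (t / 2)) := by gcongr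
    _ = 4 * σ * ((1 + σ * (t / 2)) * r (t / 2) * Q (t / 2)) := by ring
    _ ≤ 4 * σ * (2 * σ) := by gcongr
    _ = 8 * σ ^ 2 := by ring

end

noncomputable def pw (σ a : ℝ) : ℝ → ℝ := fun t => (1 + σ * max t 0) ^ a

lemma pw_base {σ : ℝ} (hσ : 0 < σ) (t : ℝ) : 1 ≤ 1 + σ * max t 0 := by
  have : 0 ≤ σ * max t 0 := mul_nonneg hσ.le (le_max_right _ _)
  linarith

lemma pw_cont {σ : ℝ} (hσ : 0 < σ) (a : ℝ) : Continuous (pw σ a) := by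
  unfold pw
  apply Continuous.rpow_const (by fun_prop)
  intro t
  left
  linarith [pw_base hσ t]

lemma pw_pos {σ : ℝ} (hσ : 0 < σ) (a t : ℝ) : 0 < pw σ a t :=
  rpow_pos_of_pos (by linarith [pw_base hσ t]) _

lemma pw_nonneg_eq (σ a : ℝ) {t : ℝ} (ht : 0 ≤ t) : pw σ a t = (1 + σ * t) ^ a := by
  unfold pw; rw [max_eq_left ht]

lemma pw_zero (σ a : ℝ) : pw σ a 0 = 1 := by simp [pw]

lemma pw_succ {σ : ℝ} (hσ : 0 < σ) (a : ℝ) {t : ℝ} (ht : 0 ≤ t) :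
    (1 + σ * t) * pw σ a t = pw σ (a + 1) t := by
  rw [pw_nonneg_eq _ _ ht, pw_nonneg_eq _ _ ht, rpow_add (by positivity), rpow_one, mul_comm]

lemma pw_anti {σ a : ℝ} (hσ : 0 < σ) (ha : a ≤ 0) {s t : ℝ} (hst : s ≤ t) :
    pw σ a t ≤ pw σ a s := by
  unfold pw
  apply rpow_le_rpow_of_nonpos (by linarith [pw_base hσ s]) _ ha
  have := max_le_max_right 0 hst
  nlinarith

lemma pw_int {σ : ℝ} (hσ : 0 < σ) (a : ℝ) {t : ℝ} (ht : 0 ≤ t) :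
    pw σ a t = 1 + (a * σ) * ∫ s in (0:ℝ)..t, pw σ (a - 1) s := by
  have e : ∫ s in (0:ℝ)..t, a * σ * pw σ (a - 1) s = (1 + σ * t) ^ a - (1 + σ * 0) ^ a := by
    apply intervalIntegral.integral_eq_sub_of_hasDerivAt (f := fun t => (1 + σ * t) ^ a)
    · intro x hx
      rw [uIcc_of_le ht] at hx
      rw [pw_nonneg_eq _ _ hx.1]
      have hx0 := hx.1
      have d : HasDerivAt (fun t => 1 + σ * t) (σ * 1) x :=
        ((hasDerivAt_id x).const_mul σ).const_add 1
      have := d.rpow_const (p := a) (Or.inl (by positivity))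
      rw [show σ * 1 * a * (1 + σ * x) ^ (a - 1) = a * σ * (1 + σ * x) ^ (a - 1) by ring] at this
      exact this
    · exact Continuous.intervalIntegrable (by have := pw_cont hσ (a - 1); fun_prop) _ _
  rw [← intervalIntegral.integral_const_mul, e, pw_nonneg_eq _ _ ht]
  simp

lemma ker_pw {α σ : ℝ} (hα0 : 0 < α) (hα1 : α < 1) (hσ : 0 < σ) :
    Ker α σ (fun t => α * σ * pw σ (-(α + 1)) t)
      (fun t => -(α * (α + 1) * σ ^ 2) * pw σ (-(α + 1) - 1) t) (pw σ (-α)) := by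
  have c1 := pw_cont hσ (-(α + 1))
  have c2 := pw_cont hσ (-(α + 1) - 1)
  have c3 := pw_cont hσ (-α)
  refine ⟨hα0, hα1, hσ, by fun_prop, by fun_prop, c3, ?_, pw_zero _ _, ?_, ?_, ?_, ?_, ?_, ?_, ?_, ?_⟩
  · simp [pw_zero]
  · intro t ht
    rw [intervalIntegral.integral_const_mul, pw_int hσ _ ht, pw_zero]; ring
  · intro t ht
    rw [intervalIntegral.integral_const_mul, pw_int hσ _ ht, show -α - 1 = -(α + 1) by ring]; ring
  · intro t ht
    have := pw_succ hσ (-(α + 1)) ht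
    rw [show -(α + 1) + 1 = -α by ring] at this
    linear_combination α * σ * this
  · intro t ht
    have := pw_succ hσ (-(α + 1) - 1) ht
    rw [show -(α + 1) - 1 + 1 = -(α + 1) by ring] at this
    linear_combination -(α * (α + 1) * σ ^ 2) * this
  · intro t ht
    have := pw_pos hσ (-(α + 1)) t
    positivity
  · intro t ht
    exact pw_pos hσ _ t
  · intro s t hs hst
    have := pw_anti hσ (show -(α + 1) ≤ 0 by linarith) hst
    show α * σ * pw σ (-(α + 1)) t ≤ α * σ * pw σ (-(α + 1)) s
    gcongr
  · intro s t hs hst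
    exact pw_anti hσ (by linarith) hst

section
variable {α σ : ℝ} {p pd Q : ℝ → ℝ}

lemma cP_cont (h : Ker α σ p pd Q) (k : ℕ) : Continuous (convPow p k) := by
  induction k with
  | zero => exact h.cp
  | succ k ih => exact conv_cont h.cp ih

lemma p_int_le (h : Ker α σ p pd Q) {t : ℝ} (ht : 0 ≤ t) : ∫ s in (0:ℝ)..t, p s ≤ 1 := by
  have := h.iQ t ht
  have := h.Qpos t ht
  linarith

lemma cP_bound (h : Ker α σ p pd Q) (k : ℕ) :
    ∀ t, 0 ≤ t → 0 ≤ convPow p k t ∧ convPow p k t ≤ α * σ := by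
  have hα := h.hα0
  have hσ := h.hσ
  induction k with
  | zero =>
    intro t ht
    refine ⟨(h.ppos t ht).le, ?_⟩
    rw [← h.p0]; exact h.panti 0 t le_rfl ht
  | succ k ih =>
    intro t ht
    refine ⟨conv_nonneg ht (fun s hs => (h.ppos s hs).le) (fun s hs => (ih s hs).1), ?_⟩
    show conv p (convPow p k) t ≤ _
    rw [conv_comm']
    calc conv (convPow p k) p t ≤ conv (fun _ => α * σ) p t :=
          conv_le_left (cP_cont h k) continuous_const h.cp ht (fun s hs _ => (ih s hs).2)
            (fun s hs => (h.ppos s hs).le)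
      _ = α * σ * ∫ s in (0:ℝ)..t, p s := conv_const _ _ _
      _ ≤ α * σ * 1 := by gcongr; exact p_int_le h ht
      _ = α * σ := mul_one _

lemma res_exists (h : Ker α σ p pd Q) {ζ : ℝ} (hζ0 : 0 < ζ) (hζ1 : ζ < 1) :
    Res ζ p (fun t => ∑' k : ℕ, ζ ^ (k + 1) * convPow p k (max t 0)) := by
  have hα := h.hα0
  have hσ := h.hσ
  have sg : Summable (fun k : ℕ => ζ ^ (k + 1) * (α * σ)) := by
    apply Summable.mul_right
    exact (summable_nat_add_iff 1).mpr (summable_geometric_of_lt_one hζ0.le hζ1)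
  have bd : ∀ (k : ℕ) (t : ℝ), 0 ≤ t → ‖ζ ^ (k + 1) * convPow p k t‖ ≤ ζ ^ (k + 1) * (α * σ) := by
    intro k t ht
    have := cP_bound h k t ht
    rw [norm_of_nonneg (mul_nonneg (by positivity) this.1)]
    gcongr
    exact this.2
  have sm : ∀ t, 0 ≤ t → Summable (fun k : ℕ => ζ ^ (k + 1) * convPow p k t) := fun t ht =>
    Summable.of_norm_bounded sg (fun k => bd k t ht)
  refine ⟨hζ0, hζ1, ?_, ?_, ?_⟩
  · apply continuous_tsum _ sg
    · intro k t
      exact bd k _ (le_max_right _ _)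
    · intro k
      have := cP_cont h k
      fun_prop
  · intro t ht
    apply tsum_nonneg
    intro k
    exact mul_nonneg (by positivity) (cP_bound h k _ (le_max_right _ _)).1
  · intro t ht
    have e1 : HasSum (fun k : ℕ => ∫ s in (0:ℝ)..t, p (t - s) * (ζ ^ (k + 1) * convPow p k (max s 0)))
        (∫ s in (0:ℝ)..t, p (t - s) * ∑' k : ℕ, ζ ^ (k + 1) * convPow p k (max s 0)) := by
      apply intervalIntegral.hasSum_integral_of_dominated_convergence
        (fun k _ => (α * σ) * (ζ ^ (k + 1) * (α * σ)))
      · intro k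
        have := cP_cont h k
        have := h.cp
        exact Continuous.aestronglyMeasurable (by fun_prop)
      · intro k
        refine Eventually.of_forall (fun s hs => ?_)
        rw [uIoc_of_le ht] at hs
        rw [norm_mul]
        have h1 : 0 ≤ t - s := by linarith [hs.2]
        apply mul_le_mul
        · rw [norm_of_nonneg (h.ppos _ h1).le, ← h.p0]
          exact h.panti 0 _ le_rfl h1
        · exact bd k _ (le_max_right _ _)
        · exact norm_nonneg _
        · positivity
      · exact Eventually.of_forall (fun s hs => sg.mul_left _)
      · exact continuous_const.intervalIntegrable _ _
      · refine Eventually.of_forall (fun s hs => ?_)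
        exact (sm _ (le_max_right _ _)).hasSum.mul_left _
    have e2 : ∀ k : ℕ, ∫ s in (0:ℝ)..t, p (t - s) * (ζ ^ (k + 1) * convPow p k (max s 0))
        = ζ ^ (k + 1) * convPow p (k + 1) t := by
      intro k
      show _ = ζ ^ (k + 1) * conv p (convPow p k) t
      rw [← conv_smul_right]
      exact conv_congr (f := p) (g := fun s => ζ ^ (k + 1) * convPow p k (max s 0)) ht
        (fun _ _ => rfl) (fun s hs => by rw [max_eq_left hs])
    simp only [e2] at e1
    have e3 : conv p (fun t => ∑' k : ℕ, ζ ^ (k + 1) * convPow p k (max t 0)) t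
      = ∑' k : ℕ, ζ ^ (k + 1) * convPow p (k + 1) t := e1.tsum_eq.symm
    rw [e3, ← tsum_mul_left]
    simp only [max_eq_left ht]
    rw [(sm t ht).tsum_eq_zero_add]
    simp only [zero_add, pow_one]
    congr 1
    congr 1; ext k; ring
end

lemma convPow_congr {f g : ℝ → ℝ} (hfg : ∀ t, 0 ≤ t → f t = g t) (k : ℕ) :
    ∀ t, 0 ≤ t → convPow f k t = convPow g k t := by
  induction k with
  | zero => exact hfg
  | succ k ih => intro t ht; exact conv_congr ht hfg ih

lemma min_bound {σ : ℝ} (hσ : 0 < σ) {t : ℝ} (ht : 0 ≤ t) :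
    min 1 (σ / 2) * (1 + t) ≤ 1 + σ * (t / 2) := by
  have h1 := min_le_left 1 (σ / 2)
  have h2 := min_le_right 1 (σ / 2)
  nlinarith

theorem uniform_resolvent_derivative_bound
    (α σ : ℝ) (hα : α ∈ Set.Ioo (1/2 : ℝ) 1) (hσ : 0 < σ)
    (φ : ℝ → ℝ) (hφ : ∀ t : ℝ, φ t = α * σ * (1 + σ * t) ^ (-(α + 1))) :
    ∃ C : ℝ, 0 < C ∧ ∀ ζ ∈ Set.Ioo (0:ℝ) 1, ∀ t : ℝ, 0 < t →
      DifferentiableAt ℝ (fun s : ℝ => ∑' k : ℕ, ζ ^ (k + 1) * convPow φ k s) t ∧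
      |deriv (fun s : ℝ => ∑' k : ℕ, ζ ^ (k + 1) * convPow φ k s) t| ≤ C * (1 + t) ^ (α - 2) := by
  have hα0 : 0 < α := by linarith [hα.1]
  have hm : 0 < min 1 (σ / 2) := lt_min one_pos (by positivity)
  refine ⟨8 * σ ^ 2 * (min 1 (σ / 2)) ^ (α - 2), by positivity, ?_⟩
  intro ζ hζ t ht
  have h := ker_pw hα0 hα.2 hσ
  have H := res_exists h hζ.1 hζ.2
  set p : ℝ → ℝ := fun t => α * σ * pw σ (-(α + 1)) t with hp
  set pd : ℝ → ℝ := fun t => -(α * (α + 1) * σ ^ 2) * pw σ (-(α + 1) - 1) t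
  set r : ℝ → ℝ := fun t => ∑' k : ℕ, ζ ^ (k + 1) * convPow p k (max t 0) with hr
  have c0 := rd_cont h H
  have key : ∀ s, 0 ≤ s → ∑' k : ℕ, ζ ^ (k + 1) * convPow φ k s
      = r 0 + ∫ x in (0:ℝ)..s, rdf ζ p pd r x := by
    intro s hs
    rw [← rd_int h H hs, hr]
    simp only [max_eq_left hs]
    congr 1; ext k
    rw [convPow_congr (g := p) _ k s hs]
    intro u hu
    rw [hφ, hp]
    simp only [pw_nonneg_eq _ _ hu]
  have d : HasDerivAt (fun s : ℝ => ∑' k : ℕ, ζ ^ (k + 1) * convPow φ k s)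
      (rdf ζ p pd r t) t := by
    apply ((c0.integral_hasStrictDerivAt 0 t).hasDerivAt.const_add (r 0)).congr_of_eventuallyEq
    filter_upwards [lt_mem_nhds ht] with s hs
    exact key s hs.le
  refine ⟨d.differentiableAt, ?_⟩
  rw [d.deriv]
  have ng := rd_neg h H ht.le
  have b := rd_bound h H ht.le
  rw [abs_of_neg ng]
  have hB : 0 < 1 + σ * (t / 2) := by positivity
  have e1 : (1 + σ * (t / 2)) ^ (2 - α) ≤ (1 + σ * t) * (1 + σ * (t / 2)) * pw σ (-α) (t / 2) := by
    rw [pw_nonneg_eq _ _ (by positivity), show 2 - α = 1 + 1 + (-α) by ring, rpow_add hB,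
      rpow_add hB, rpow_one]
    gcongr
    linarith
  have e2 : (1 + σ * (t / 2)) ^ (α - 2) ≤ (min 1 (σ / 2) * (1 + t)) ^ (α - 2) :=
    rpow_le_rpow_of_nonpos (by positivity) (min_bound hσ ht.le) (by linarith [hα.2])
  have e3 : (1 + σ * (t / 2)) ^ (2 - α) * (1 + σ * (t / 2)) ^ (α - 2) = 1 := by
    rw [← rpow_add hB]; simp
  have hn : 0 ≤ -rdf ζ p pd r t := by linarith
  calc -rdf ζ p pd r t = -rdf ζ p pd r t * (1 + σ * (t / 2)) ^ (2 - α) *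
        (1 + σ * (t / 2)) ^ (α - 2) := by rw [mul_assoc, e3, mul_one]
    _ ≤ -rdf ζ p pd r t * ((1 + σ * t) * (1 + σ * (t / 2)) * pw σ (-α) (t / 2)) *
        (1 + σ * (t / 2)) ^ (α - 2) := by gcongr
    _ ≤ 8 * σ ^ 2 * (1 + σ * (t / 2)) ^ (α - 2) := by gcongr
    _ ≤ 8 * σ ^ 2 * (min 1 (σ / 2) * (1 + t)) ^ (α - 2) := by gcongr
    _ = 8 * σ ^ 2 * (min 1 (σ / 2)) ^ (α - 2) * (1 + t) ^ (α - 2) := by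
      rw [mul_rpow hm.le (by positivity)]; ring
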